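/- arXiv:2503.11107 — 2 statements merged into one kernel-verified Lean document; each statement's English description precedes it below -/
import Mathlib

section
/- Suppose every revenue function R_j : {0,1,...,m} → ℝ is convex. Then for every k with 0 ≤ k ≤ n·m there exists an optimal k-profile x such that at most one index j ∈ {1,...,n} satisfies 0 < x_j < m. -/
/-- `x` is a `k`-profile: each project gets between `0` and `m` efforts and the
total number of efforts is `k`. -/
def IsProfile (n m k : ℕ) (x : Fin n → ℕ) : Prop :=
  (∀ j, x j ≤ m) ∧ ∑ j, x j = k

/-- The revenue of a profile. -/
def revenue {n : ℕ} (R : Fin n → ℕ → ℝ) (x : Fin n → ℕ) : ℝ :=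
  ∑ j, R j (x j)

/-- `x` is an optimal `k`-profile. -/
def IsOptimalProfile (n m k : ℕ) (R : Fin n → ℕ → ℝ) (x : Fin n → ℕ) : Prop :=
  IsProfile n m k x ∧ ∀ y, IsProfile n m k y → revenue R y ≤ revenue R x

theorem sum_apply_update_add {ι M : Type*} [Fintype ι] [DecidableEq ι] [AddCommMonoid M]
    (f : ι → ℕ → M) (x : ι → ℕ) (i : ι) (a : ℕ) :
    ∑ l, f l (Function.update x i a l) + f i (x i) = ∑ l, f l (x l) + f i a := by
  have h : ∑ l ∈ Finset.univ.erase i, f l (Function.update x i a l) =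
      ∑ l ∈ Finset.univ.erase i, f l (x l) :=
    Finset.sum_congr rfl fun l hl ↦ by
      rw [Function.update_of_ne (Finset.ne_of_mem_erase hl)]
  rw [← Finset.sum_erase_add _ _ (Finset.mem_univ i), h,
    ← Finset.sum_erase_add _ (fun l ↦ f l (x l)) (Finset.mem_univ i), Function.update_self]
  exact add_right_comm _ _ _

theorem exists_isProfile (n m k : ℕ) (hk : k ≤ n * m) : ∃ x, IsProfile n m k x := by
  induction k with
  | zero => exact ⟨0, by simp [IsProfile]⟩
  | succ k ih =>
    obtain ⟨x, hxm, hxk⟩ := ih (by omega)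
    obtain ⟨j, -, hj⟩ : ∃ j ∈ Finset.univ, x j < m := by
      apply Finset.exists_lt_of_sum_lt
      simp only [hxk, Finset.sum_const, Finset.card_univ, Fintype.card_fin, smul_eq_mul]
      omega
    refine ⟨Function.update x j (x j + 1), fun l ↦ ?_, ?_⟩
    · rw [Function.update_apply]
      split_ifs
      exacts [hj, hxm l]
    · have := sum_apply_update_add (fun _ t ↦ t) x j (x j + 1)
      omega

theorem finite_setOf_isProfile (n m k : ℕ) : {x | IsProfile n m k x}.Finite :=
  (Set.finite_Iic fun _ ↦ m).subset fun _ hx ↦ hx.1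

theorem exists_isOptimalProfile (n m k : ℕ) (R : Fin n → ℕ → ℝ) (hk : k ≤ n * m) :
    ∃ x, IsOptimalProfile n m k R x := by
  obtain ⟨x, hx, hmax⟩ := Set.exists_max_image _ (revenue R) (finite_setOf_isProfile n m k)
    (exists_isProfile n m k hk)
  exact ⟨x, hx, hmax⟩

/-- Move one unit of effort from project `j` to project `i`. -/
def transfer {n : ℕ} (x : Fin n → ℕ) (i j : Fin n) : Fin n → ℕ :=
  Function.update (Function.update x i (x i + 1)) j (x j - 1)

theorem sum_apply_transfer_add {n : ℕ} {M : Type*} [AddCommMonoid M] (f : Fin n → ℕ → M)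
    (x : Fin n → ℕ) {i j : Fin n} (hij : i ≠ j) :
    ∑ l, f l (transfer x i j l) + (f i (x i) + f j (x j)) =
      ∑ l, f l (x l) + (f i (x i + 1) + f j (x j - 1)) := by
  have h₁ := sum_apply_update_add f x i (x i + 1)
  have h₂ := sum_apply_update_add f (Function.update x i (x i + 1)) j (x j - 1)
  rw [Function.update_of_ne hij.symm] at h₂
  rw [transfer, add_comm (f i _), ← add_assoc, h₂, add_right_comm, h₁, add_assoc]

theorem IsProfile.transfer {n m k : ℕ} {x : Fin n → ℕ} (hx : IsProfile n m k x) {i j : Fin n}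
    (hij : i ≠ j) (hi : x i < m) (hj : 0 < x j) : IsProfile n m k (transfer x i j) := by
  refine ⟨fun l ↦ ?_, ?_⟩
  · have := hx.1 l
    simp only [_root_.transfer, Function.update_apply]
    split_ifs <;> subst_vars <;> omega
  · have := sum_apply_transfer_add (fun _ t ↦ t) x hij
    have := hx.2
    omega

theorem exists_optimal_profile_at_most_one_partial
    (n m : ℕ) (R : Fin n → ℕ → ℝ)
    (hR0 : ∀ j, R j 0 = 0)
    (hconv : ∀ (j : Fin n) (t : ℕ), 1 ≤ t → t + 1 ≤ m →
      R j t - R j (t - 1) ≤ R j (t + 1) - R j t)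
    (k : ℕ) (hk : k ≤ n * m) :
    ∃ x : Fin n → ℕ, IsOptimalProfile n m k R x ∧
      ∀ i j : Fin n, (0 < x i ∧ x i < m) → (0 < x j ∧ x j < m) → i = j := by
  -- Among the optimal profiles, one maximizing the sum of squares works.
  obtain ⟨x, hx, hmax⟩ := Set.exists_max_image {x | IsOptimalProfile n m k R x}
    (fun x ↦ ∑ l, x l ^ 2) ((finite_setOf_isProfile n m k).subset fun _ hx ↦ hx.1)
    (exists_isOptimalProfile n m k R hk)
  refine ⟨x, hx, fun i j ⟨hi₀, him⟩ ⟨hj₀, hjm⟩ ↦ by_contra fun hij ↦ ?_⟩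
  have hy := hx.1.transfer hij him hj₀
  have hz := hx.1.transfer (Ne.symm hij) hjm hi₀
  have hy_le := hx.2 _ hy
  have hz_le := hx.2 _ hz
  have hy_rev := sum_apply_transfer_add R x hij
  have hz_rev := sum_apply_transfer_add R x (Ne.symm hij)
  have hci := hconv i (x i) hi₀ him
  have hcj := hconv j (x j) hj₀ hjm
  have hy_max := hmax (transfer x i j)
    ⟨hy, fun w hw ↦ (hx.2 w hw).trans (by simp only [revenue] at *; linarith)⟩
  have hz_max := hmax (transfer x j i)
    ⟨hz, fun w hw ↦ (hx.2 w hw).trans (by simp only [revenue] at *; linarith)⟩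
  have hy_sq := sum_apply_transfer_add (fun _ t ↦ t ^ 2) x hij
  have hz_sq := sum_apply_transfer_add (fun _ t ↦ t ^ 2) x (Ne.symm hij)
  obtain ⟨a, ha⟩ := Nat.exists_eq_add_of_lt hi₀
  obtain ⟨b, hb⟩ := Nat.exists_eq_add_of_lt hj₀
  simp only [ha, hb, zero_add, Nat.add_sub_cancel] at hy_sq hz_sq
  nlinarith
end

section
/- Let a_1, ..., a_n and b_1, ..., b_n be real numbers with a_i ≤ b_i for every i, and suppose the projects are sorted so that a_1 + b_1 ≥ a_2 + b_2 ≥ ... ≥ a_n + b_n. For 0 ≤ k ≤ 2n let g(k) be the maximum of Σ_{i : x_i ≥ 1} a_i + Σ_{i : x_i = 2} b_i over all vectors x ∈ {0,1,2}^n with Σ_i x_i = k. Then the sequence g(2k) − g(2k−1) is non-increasing in k; that is, g(2k) − g(2k−1) ≥ g(2k+2) − g(2k+1) for all 1 ≤ k ≤ n−1. -/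
/-- Total revenue of an allocation `x` (with `x i ∈ {0,1,2}`) to projects `1, …, n`:
project `i` yields `0`, `a i`, or `a i + b i` when allocated `0`, `1`, or `2` efforts. -/
def rev (n : ℕ) (a b : ℕ → ℝ) (x : ℕ → ℕ) : ℝ :=
  ∑ i ∈ Finset.Icc 1 n, ((if 1 ≤ x i then a i else 0) + (if x i = 2 then b i else 0))

theorem sum_update_add {M : Type*} [AddCommMonoid M] {s : Finset ℕ} (f : ℕ → ℕ → M)
    (x : ℕ → ℕ) {i : ℕ} (hi : i ∈ s) (v : ℕ) :
    ∑ j ∈ s, f j (Function.update x i v j) + f i (x i) = ∑ j ∈ s, f j (x j) + f i v := by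
  rw [← Finset.add_sum_erase s _ hi, ← Finset.add_sum_erase s (fun j => f j (x j)) hi,
    Finset.sum_congr rfl (g := fun j => f j (x j)) fun j hj => by
      rw [Function.update_of_ne (Finset.ne_of_mem_erase hj)]]
  simp only [Function.update_self]
  abel

theorem rev_update (n : ℕ) (a b : ℕ → ℝ) (x : ℕ → ℕ) {i : ℕ} (hi : i ∈ Finset.Icc 1 n) (v : ℕ) :
    rev n a b (Function.update x i v) +
        ((if 1 ≤ x i then a i else 0) + (if x i = 2 then b i else 0)) =
      rev n a b x + ((if 1 ≤ v then a i else 0) + (if v = 2 then b i else 0)) :=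
  sum_update_add (fun j w => (if 1 ≤ w then a j else 0) + (if w = 2 then b j else 0)) x hi v

theorem update_le_two {s : Finset ℕ} {x : ℕ → ℕ} (hx : ∀ i ∈ s, x i ≤ 2) (i : ℕ) {v : ℕ}
    (hv : v ≤ 2) : ∀ j ∈ s, Function.update x i v j ≤ 2 := by
  intro j hj
  by_cases h : j = i
  · subst h; simpa using hv
  · simpa [Function.update_of_ne h] using hx j hj

theorem exists_ne_eq_one_of_two_le_sum {s : Finset ℕ} {f : ℕ → ℕ} (hf : ∀ i ∈ s, f i ≤ 1)
    (h : 2 ≤ ∑ i ∈ s, f i) : ∃ i ∈ s, ∃ j ∈ s, i ≠ j ∧ f i = 1 ∧ f j = 1 := by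
  have hcard : ∑ i ∈ s, f i = (s.filter fun i => f i = 1).card := by
    rw [Finset.card_filter]
    refine Finset.sum_congr rfl fun i hi => ?_
    have := hf i hi
    split_ifs <;> omega
  obtain ⟨i, hi, j, hj, hij⟩ := Finset.one_lt_card.mp
    (show 1 < (s.filter fun i => f i = 1).card by omega)
  rw [Finset.mem_filter] at hi hj
  exact ⟨i, hi.1, j, hj.1, hij, hi.2, hj.2⟩

/-- Two further efforts can be placed with a gain of at least `a p + b p`, as long as the first `p`
projects are not nearly saturated. -/
theorem exists_allocation_add_two {n p m : ℕ} {a b : ℕ → ℝ} {x : ℕ → ℕ}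
    (hab : ∀ i ∈ Finset.Icc 1 n, a i ≤ b i)
    (hsort : ∀ i j : ℕ, 1 ≤ i → i ≤ j → j ≤ n → a j + b j ≤ a i + b i)
    (hp : p ≤ n) (hx : ∀ i ∈ Finset.Icc 1 n, x i ≤ 2)
    (hsum : ∑ i ∈ Finset.Icc 1 n, x i = m) (hm : m + 2 ≤ 2 * p) :
    ∃ y : ℕ → ℕ, (∀ i ∈ Finset.Icc 1 n, y i ≤ 2) ∧ ∑ i ∈ Finset.Icc 1 n, y i = m + 2 ∧
      rev n a b x + (a p + b p) ≤ rev n a b y := by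
  have hsub : Finset.Icc 1 p ⊆ Finset.Icc 1 n := Finset.Icc_subset_Icc_right hp
  by_cases h0 : ∃ i ∈ Finset.Icc 1 p, x i = 0
  · obtain ⟨i, hi, hxi⟩ := h0
    have hs := sum_update_add (fun _ w => w) x (hsub hi) 2
    have hr := rev_update n a b x (hsub hi) 2
    simp [hxi] at hs hr
    rw [Finset.mem_Icc] at hi
    have := hsort i p hi.1 hi.2 hp
    exact ⟨_, update_le_two hx i le_rfl, by omega, by linarith⟩
  · push Not at h0
    have hle : ∑ i ∈ Finset.Icc 1 p, x i ≤ m := hsum ▸ Finset.sum_le_sum_of_subset hsub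
    have hadd : ∑ i ∈ Finset.Icc 1 p, (2 - x i) + ∑ i ∈ Finset.Icc 1 p, x i = 2 * p := by
      rw [← Finset.sum_add_distrib, Finset.sum_congr rfl (g := fun _ => 2) fun i hi => by
        have := hx i (hsub hi); omega]
      simp [mul_comm]
    obtain ⟨i, hi, j, hj, hij, hxi, hxj⟩ := exists_ne_eq_one_of_two_le_sum
      (f := fun i => 2 - x i) (fun i hi => by have := h0 i hi; omega)
      (show 2 ≤ ∑ i ∈ Finset.Icc 1 p, (2 - x i) by omega)
    replace hxi : x i = 1 := by omega
    replace hxj : x j = 1 := by omega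
    have hs := sum_update_add (fun _ w => w) x (hsub hi) 2
    have hr := rev_update n a b x (hsub hi) 2
    have hs' := sum_update_add (fun _ w => w) (Function.update x i 2) (hsub hj) 2
    have hr' := rev_update n a b (Function.update x i 2) (hsub hj) 2
    simp [hxi] at hs hr
    simp [Function.update_of_ne hij.symm, hxj] at hs' hr'
    have hai := hab i (hsub hi)
    have haj := hab j (hsub hj)
    rw [Finset.mem_Icc] at hi hj
    have hci := hsort i p hi.1 hi.2 hp
    have hcj := hsort j p hj.1 hj.2 hp
    exact ⟨_, update_le_two (update_le_two hx i le_rfl) j le_rfl, by omega, by linarith⟩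

/-- Two efforts can be withdrawn with a loss of at most `a p + b p`, as long as the first `p - 1`
projects cannot absorb all but one effort. -/
theorem exists_allocation_sub_two {n p m : ℕ} {a b : ℕ → ℝ} {x : ℕ → ℕ}
    (hab : ∀ i ∈ Finset.Icc 1 n, a i ≤ b i)
    (hsort : ∀ i j : ℕ, 1 ≤ i → i ≤ j → j ≤ n → a j + b j ≤ a i + b i)
    (hp1 : 1 ≤ p) (hp : p ≤ n) (hx : ∀ i ∈ Finset.Icc 1 n, x i ≤ 2)
    (hsum : ∑ i ∈ Finset.Icc 1 n, x i = m + 2) (hm : 2 * p ≤ m + 2) :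
    ∃ y : ℕ → ℕ, (∀ i ∈ Finset.Icc 1 n, y i ≤ 2) ∧ ∑ i ∈ Finset.Icc 1 n, y i = m ∧
      rev n a b x ≤ rev n a b y + (a p + b p) := by
  have hsub : Finset.Icc p n ⊆ Finset.Icc 1 n := Finset.Icc_subset_Icc_left hp1
  by_cases h2 : ∃ i ∈ Finset.Icc p n, x i = 2
  · obtain ⟨i, hi, hxi⟩ := h2
    have hs := sum_update_add (fun _ w => w) x (hsub hi) 0
    have hr := rev_update n a b x (hsub hi) 0
    simp [hxi] at hs hr
    rw [Finset.mem_Icc] at hi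
    have := hsort p i hp1 hi.1 hi.2
    exact ⟨_, update_le_two hx i (Nat.zero_le 2), by omega, by linarith⟩
  · push Not at h2
    have hsplit := Finset.sum_sdiff (f := x) hsub
    have hle : ∑ i ∈ Finset.Icc 1 n \ Finset.Icc p n, x i ≤ (p - 1) * 2 := by
      have := Finset.sum_le_card_nsmul (Finset.Icc 1 n \ Finset.Icc p n) x 2
        fun i hi => hx i (Finset.mem_sdiff.mp hi).1
      rw [Finset.card_sdiff_of_subset hsub, Nat.card_Icc, Nat.card_Icc, smul_eq_mul] at this
      exact this.trans (Nat.mul_le_mul_right 2 (by omega))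
    obtain ⟨i, hi, j, hj, hij, hxi, hxj⟩ := exists_ne_eq_one_of_two_le_sum
      (f := x) (fun i hi => by have := h2 i hi; have := hx i (hsub hi); omega)
      (show 2 ≤ ∑ i ∈ Finset.Icc p n, x i by omega)
    have hs := sum_update_add (fun _ w => w) x (hsub hi) 0
    have hr := rev_update n a b x (hsub hi) 0
    have hs' := sum_update_add (fun _ w => w) (Function.update x i 0) (hsub hj) 0
    have hr' := rev_update n a b (Function.update x i 0) (hsub hj) 0
    simp [hxi] at hs hr
    simp [Function.update_of_ne hij.symm, hxj] at hs' hr'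
    have hai := hab i (hsub hi)
    have haj := hab j (hsub hj)
    rw [Finset.mem_Icc] at hi hj
    have hci := hsort p i hp1 hi.1 hi.2
    have hcj := hsort p j hp1 hj.1 hj.2
    exact ⟨_, update_le_two (update_le_two hx i (Nat.zero_le 2)) j (Nat.zero_le 2), by omega,
      by linarith⟩

theorem max_revenue_property_five
    (n : ℕ) (a b : ℕ → ℝ) (g : ℕ → ℝ)
    (hab : ∀ i ∈ Finset.Icc 1 n, a i ≤ b i)
    (hsort : ∀ i j : ℕ, 1 ≤ i → i ≤ j → j ≤ n → a j + b j ≤ a i + b i)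
    (hg : ∀ k ≤ 2 * n,
      IsGreatest
        {r : ℝ | ∃ x : ℕ → ℕ, (∀ i ∈ Finset.Icc 1 n, x i ≤ 2) ∧
          (∑ i ∈ Finset.Icc 1 n, x i = k) ∧ r = rev n a b x}
        (g k)) :
    ∀ k : ℕ, 1 ≤ k → k + 1 ≤ n →
      g (2 * k + 2) - g (2 * k + 1) ≤ g (2 * k) - g (2 * k - 1) := by
  intro k hk hkn
  obtain ⟨x, hx, hxs, hxr⟩ := (hg (2 * k - 1) (by omega)).1
  obtain ⟨y, hy, hys, hyr⟩ := (hg (2 * k + 2) (by omega)).1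
  obtain ⟨x', hx', hxs', hxr'⟩ := exists_allocation_add_two hab hsort hkn hx hxs (by omega)
  obtain ⟨y', hy', hys', hyr'⟩ :=
    exists_allocation_sub_two hab hsort (Nat.le_add_left 1 k) hkn hy hys (by omega)
  have h1 := (hg (2 * k + 1) (by omega)).2 ⟨x', hx', by omega, rfl⟩
  have h2 := (hg (2 * k) (by omega)).2 ⟨y', hy', hys', rfl⟩
  linarith
end
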